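/- Let ε > 0, α > 0 and let μ be a finite Borel measure on ℝ³ which is upper 2-regular with some constant A > 0. Define u(x) := ∫_{ℝ³} 𝒢_ε(x,y) dμ(y) for x ∈ ℝ³. Then for every smooth compactly supported function φ : ℝ³ → ℝ one has ∫_{ℝ³} (ε² Δφ(x) − α² φ(x)) u(x) dx = −∫_{ℝ³} φ(y) dμ(y). (That is, the single-layer potential u is a distributional solution of ε²Δu − α²u = −μ on ℝ³.) -/

import Mathlib

open MeasureTheory Real Filter
open scoped ENNReal

noncomputable section

/-- The screened Coulomb (Yukawa) kernel on ℝ³.  Note that at `x = y` the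
formula evaluates (with Lean's convention `1/0 = 0`) to `0`, matching the
convention `𝒢_ε(x,x) = 0`. -/
def yukawa (ε α : ℝ) (x y : EuclideanSpace ℝ (Fin 3)) : ℝ :=
  Real.exp (-(α / ε) * ‖x - y‖) / (4 * π * ε ^ 2 * ‖x - y‖)

/-- The Laplacian of `φ : ℝ³ → ℝ`: the sum of the second partial derivatives. -/
def lap (φ : EuclideanSpace ℝ (Fin 3) → ℝ) (x : EuclideanSpace ℝ (Fin 3)) : ℝ :=
  ∑ i : Fin 3,
    fderiv ℝ (fun z => fderiv ℝ φ z (EuclideanSpace.single i 1)) x (EuclideanSpace.single i 1)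

/-- A Borel measure `μ` on ℝ³ is upper 2-regular with constant `A` if
`μ(B̄(x,r)) ≤ A r²` for every center `x` and radius `r > 0`. -/
def Upper2Regular (μ : Measure (EuclideanSpace ℝ (Fin 3))) (A : ℝ) : Prop :=
  ∀ (x : EuclideanSpace ℝ (Fin 3)) (r : ℝ), 0 < r →
    μ (Metric.closedBall x r) ≤ ENNReal.ofReal (A * r ^ 2)

open Set Topology

local notation "ℝ³" => EuclideanSpace ℝ (Fin 3)

/-- The smooth regularization `√(‖x‖² + η²)` of the norm. -/
def softNorm (η : ℝ) (x : ℝ³) : ℝ := √(‖x‖ ^ 2 + η ^ 2)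

/-- The radial profile of `-η⁻² (Δ - k²)` applied to `exp (-k q) / q` with `q = softNorm η`. -/
def kernelProfile (k q : ℝ) : ℝ := Real.exp (-k * q) * (k ^ 2 * q ^ 2 + 3 * k * q + 3) / q ^ 5

lemma softNorm_pos {η : ℝ} (hη : 0 < η) (x : ℝ³) : 0 < softNorm η x := by
  unfold softNorm; positivity

lemma softNorm_sq (η : ℝ) (x : ℝ³) : softNorm η x ^ 2 = ‖x‖ ^ 2 + η ^ 2 :=
  Real.sq_sqrt (by positivity)

lemma norm_le_softNorm (η : ℝ) (x : ℝ³) : ‖x‖ ≤ softNorm η x :=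
  Real.le_sqrt_of_sq_le (by nlinarith [sq_nonneg η])

@[fun_prop]
lemma continuous_softNorm (η : ℝ) : Continuous (softNorm η) := by
  unfold softNorm; fun_prop

lemma softNorm_smul {η : ℝ} (hη : 0 ≤ η) (x : ℝ³) : softNorm η (η • x) = η * softNorm 1 x := by
  unfold softNorm
  rw [norm_smul, Real.norm_of_nonneg hη,
    show (η * ‖x‖) ^ 2 + η ^ 2 = η ^ 2 * (‖x‖ ^ 2 + 1 ^ 2) by ring,
    Real.sqrt_mul (by positivity), Real.sqrt_sq hη]

lemma hasLineDerivAt_softNorm {η : ℝ} (hη : 0 < η) (x : ℝ³) (i : Fin 3) :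
    HasLineDerivAt ℝ (softNorm η) (x i / softNorm η x) x (EuclideanSpace.single i 1) := by
  have h1 : HasFDerivAt (fun z : ℝ³ => ‖z‖ ^ 2 + η ^ 2) (2 • innerSL ℝ x) x :=
    (hasStrictFDerivAt_norm_sq x).hasFDerivAt.add_const _
  have h2 := (h1.sqrt (by positivity)).hasLineDerivAt (EuclideanSpace.single i 1)
  refine h2.congr_deriv ?_
  simp [softNorm, EuclideanSpace.inner_single_right]
  field_simp

lemma HasDerivAt.comp_softNorm {η : ℝ} (hη : 0 < η) {H : ℝ → ℝ} {H' : ℝ} (x : ℝ³) (i : Fin 3)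
    (hH : HasDerivAt H H' (softNorm η x)) :
    HasLineDerivAt ℝ (fun z => H (softNorm η z)) (H' * (x i / softNorm η x)) x
      (EuclideanSpace.single i 1) := by
  have h := hasLineDerivAt_softNorm hη x i
  unfold HasLineDerivAt at h ⊢
  refine HasDerivAt.comp (h₂ := H) (0 : ℝ) ?_ h
  simpa using hH

lemma hasDerivAt_exp_div (k : ℝ) {q : ℝ} (hq : 0 < q) :
    HasDerivAt (fun q => Real.exp (-k * q) / q) (-(Real.exp (-k * q) * (k * q + 1) / q ^ 2)) q := by
  have h := (((hasDerivAt_id q).const_mul (-k)).exp).div (hasDerivAt_id q) hq.ne'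
  refine h.congr_deriv ?_
  simp
  field_simp
  ring

lemma hasDerivAt_exp_div_cube (k : ℝ) {q : ℝ} (hq : 0 < q) :
    HasDerivAt (fun q => -(Real.exp (-k * q) * (k * q + 1) / q ^ 3))
      (q * kernelProfile k q) q := by
  have h := (((((hasDerivAt_id q).const_mul (-k)).exp).mul
    (((hasDerivAt_id q).const_mul k).add_const 1)).div ((hasDerivAt_id q).pow 3)
      (pow_ne_zero 3 hq.ne')).neg
  refine h.congr_deriv ?_
  simp [kernelProfile]
  field_simp
  ring

lemma hasLineDerivAt_coord (x : ℝ³) (i : Fin 3) :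
    HasLineDerivAt ℝ (fun z : ℝ³ => z i) 1 x (EuclideanSpace.single i 1) := by
  have h := (EuclideanSpace.proj (𝕜 := ℝ) (ι := Fin 3) i : ℝ³ →L[ℝ] ℝ).hasFDerivAt (x := x)
  simpa using h.hasLineDerivAt (EuclideanSpace.single i 1)

lemma integral_lineDeriv_mul {ψ ψ' g g' : ℝ³ → ℝ} {v : ℝ³} (hψc : HasCompactSupport ψ)
    (hψc' : HasCompactSupport ψ') (hψ : Continuous ψ) (hψ' : Continuous ψ') (hg : Continuous g)
    (hg' : Continuous g') (hψd : ∀ x, HasLineDerivAt ℝ ψ (ψ' x) x v)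
    (hgd : ∀ x, HasLineDerivAt ℝ g (g' x) x v) :
    ∫ x, ψ' x * g x = -∫ x, ψ x * g' x := by
  have h := integral_bilinear_hasLineDerivAt_right_eq_neg_left_of_integrable
    (μ := volume) (B := ContinuousLinearMap.mul ℝ ℝ) (f := ψ) (f' := ψ') (g := g) (g' := g') (v := v)
    ((hψ'.mul hg).integrable_of_hasCompactSupport hψc'.mul_right)
    ((hψ.mul hg').integrable_of_hasCompactSupport hψc.mul_right)
    ((hψ.mul hg).integrable_of_hasCompactSupport hψc.mul_right)
    (fun x _ => hψd x) (fun x _ => hgd x)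
  simp only [ContinuousLinearMap.mul_apply'] at h
  rw [h, neg_neg]

lemma ContDiff.fderiv_apply_const {φ : ℝ³ → ℝ} (hφ : ContDiff ℝ (⊤ : ℕ∞) φ) (v : ℝ³) :
    ContDiff ℝ (⊤ : ℕ∞) (fun z => fderiv ℝ φ z v) :=
  (hφ.fderiv_right (by simp)).clm_apply contDiff_const

lemma continuous_lap {φ : ℝ³ → ℝ} (hφ : ContDiff ℝ (⊤ : ℕ∞) φ) : Continuous (lap φ) := by
  unfold lap
  exact continuous_finsetSum _ fun i _ =>
    ((hφ.fderiv_apply_const _).fderiv_apply_const _).continuous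

lemma hasCompactSupport_lap {φ : ℝ³ → ℝ} (hφc : HasCompactSupport φ) :
    HasCompactSupport (lap φ) := by
  refine hφc.mono' (Function.support_subset_iff'.2 fun x hx => Finset.sum_eq_zero fun i _ => ?_)
  have hx' : x ∉ tsupport (fun z => fderiv ℝ φ z (EuclideanSpace.single i 1)) := fun h =>
    hx (tsupport_fderiv_apply_subset ℝ _ h)
  exact image_eq_zero_of_notMem_tsupport
    (f := fun x => fderiv ℝ (fun z => fderiv ℝ φ z (EuclideanSpace.single i 1)) x
      (EuclideanSpace.single i 1)) fun h => hx' (tsupport_fderiv_apply_subset ℝ _ h)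

lemma continuous_exp_div_softNorm (k : ℝ) {η : ℝ} (hη : 0 < η) :
    Continuous fun x : ℝ³ => Real.exp (-k * softNorm η x) / softNorm η x := by
  fun_prop (disch := exact fun x => (softNorm_pos hη x).ne')

lemma continuous_exp_div_softNorm_cube (k : ℝ) {η : ℝ} (hη : 0 < η) : Continuous fun x : ℝ³ =>
    -(Real.exp (-k * softNorm η x) * (k * softNorm η x + 1) / softNorm η x ^ 3) := by
  fun_prop (disch := exact fun x => pow_ne_zero _ (softNorm_pos hη x).ne')

lemma continuous_kernelProfile_softNorm (k : ℝ) {η : ℝ} (hη : 0 < η) :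
    Continuous fun x : ℝ³ => kernelProfile k (softNorm η x) := by
  unfold kernelProfile
  fun_prop (disch := exact fun x => pow_ne_zero _ (softNorm_pos hη x).ne')

lemma integral_secondDeriv_mul {φ : ℝ³ → ℝ} (hφ : ContDiff ℝ (⊤ : ℕ∞) φ)
    (hφc : HasCompactSupport φ) (k : ℝ) {η : ℝ} (hη : 0 < η) (i : Fin 3) :
    ∫ x, fderiv ℝ (fun z => fderiv ℝ φ z (EuclideanSpace.single i 1)) x
        (EuclideanSpace.single i 1) * (Real.exp (-k * softNorm η x) / softNorm η x)
      = ∫ x, φ x * (-(Real.exp (-k * softNorm η x) * (k * softNorm η x + 1) / softNorm η x ^ 3)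
          + x i ^ 2 * kernelProfile k (softNorm η x)) := by
  set v : ℝ³ := EuclideanSpace.single i 1
  have hne : ∀ x, softNorm η x ≠ 0 := fun x => (softNorm_pos hη x).ne'
  have hφ1 := hφ.fderiv_apply_const v
  have hφ2 := (hφ1.fderiv_apply_const v).continuous
  have hc1 : HasCompactSupport (fun z => fderiv ℝ φ z v) := hφc.fderiv_apply ℝ v
  have hc2 : HasCompactSupport (fun z => fderiv ℝ (fun z => fderiv ℝ φ z v) z v) :=
    hc1.fderiv_apply ℝ v
  have hA := continuous_exp_div_softNorm_cube k hη
  have hK := continuous_kernelProfile_softNorm k hη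
  have hF := continuous_exp_div_softNorm k hη
  rw [integral_lineDeriv_mul hc1 hc2 hφ1.continuous hφ2 hF
    (g' := fun x => x i *
      -(Real.exp (-k * softNorm η x) * (k * softNorm η x + 1) / softNorm η x ^ 3)) (by fun_prop)
    (fun x => (hφ1.differentiable (by simp) x).hasFDerivAt.hasLineDerivAt v)
    (fun x => ?_),
    integral_lineDeriv_mul hφc hc1 hφ.continuous hφ1.continuous
    (g := fun x => x i *
      -(Real.exp (-k * softNorm η x) * (k * softNorm η x + 1) / softNorm η x ^ 3)) (by fun_prop)
    (g' := fun x => -(Real.exp (-k * softNorm η x) * (k * softNorm η x + 1) / softNorm η x ^ 3)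
          + x i ^ 2 * kernelProfile k (softNorm η x)) (by fun_prop)
    (fun x => (hφ.differentiable (by simp) x).hasFDerivAt.hasLineDerivAt v)
    (fun x => ?_), neg_neg]
  · have h1 := hasLineDerivAt_coord x i
    have h2 := (hasDerivAt_exp_div_cube k (softNorm_pos hη x)).comp_softNorm hη x i
    unfold HasLineDerivAt at h1 h2 ⊢
    refine (h1.mul h2).congr_deriv ?_
    simp only [zero_smul, add_zero]
    have := hne x
    field_simp
  · refine ((hasDerivAt_exp_div k (softNorm_pos hη x)).comp_softNorm hη x i).congr_deriv ?_
    have := hne x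
    field_simp

lemma integral_lap_sub_mul {φ : ℝ³ → ℝ} (hφ : ContDiff ℝ (⊤ : ℕ∞) φ)
    (hφc : HasCompactSupport φ) (k : ℝ) {η : ℝ} (hη : 0 < η) :
    ∫ x, (lap φ x - k ^ 2 * φ x) * (Real.exp (-k * softNorm η x) / softNorm η x)
      = -∫ x, φ x * (η ^ 2 * kernelProfile k (softNorm η x)) := by
  have hne : ∀ x, softNorm η x ≠ 0 := fun x => (softNorm_pos hη x).ne'
  have hA := continuous_exp_div_softNorm_cube k hη
  have hK := continuous_kernelProfile_softNorm k hη
  have hF := continuous_exp_div_softNorm k hη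
  have hφ0 := hφ.continuous
  have hF2 : Integrable fun x => k ^ 2 * φ x * (Real.exp (-k * softNorm η x) / softNorm η x) := by
    simp only [mul_assoc]
    exact ((hφ0.mul hF).integrable_of_hasCompactSupport hφc.mul_right).const_mul (k ^ 2)
  have hF1 (i : Fin 3) : Integrable fun x =>
      fderiv ℝ (fun z => fderiv ℝ φ z (EuclideanSpace.single i 1)) x
        (EuclideanSpace.single i 1) * (Real.exp (-k * softNorm η x) / softNorm η x) :=
    (((hφ.fderiv_apply_const _).fderiv_apply_const _).continuous.mul
      hF).integrable_of_hasCompactSupport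
        ((hφc.fderiv_apply ℝ _).fderiv_apply ℝ _).mul_right
  have hF3 (i : Fin 3) : Integrable fun x => φ x *
      (-(Real.exp (-k * softNorm η x) * (k * softNorm η x + 1) / softNorm η x ^ 3)
          + x i ^ 2 * kernelProfile k (softNorm η x)) :=
    Continuous.integrable_of_hasCompactSupport (by fun_prop) hφc.mul_right
  simp only [lap, sub_mul, Finset.sum_mul]
  rw [integral_sub (integrable_finsetSum _ fun i _ => hF1 i) hF2,
    integral_finsetSum _ fun i _ => hF1 i]
  simp only [integral_secondDeriv_mul hφ hφc k hη]
  rw [← integral_finsetSum _ fun i _ => hF3 i,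
    ← integral_sub (integrable_finsetSum _ fun i _ => hF3 i) hF2, ← integral_neg]
  congr 1 with x
  have h2 := softNorm_sq η x
  rw [EuclideanSpace.norm_sq_eq] at h2
  simp only [Fin.sum_univ_three, Real.norm_eq_abs, sq_abs] at h2 ⊢
  have h3 : η ^ 2 = softNorm η x ^ 2 - (x 0 ^ 2 + x 1 ^ 2 + x 2 ^ 2) := by linarith
  rw [h3]
  have := hne x
  unfold kernelProfile
  field_simp
  ring

lemma kernelProfile_nonneg {k q : ℝ} (hk : 0 ≤ k) (hq : 0 ≤ q) : 0 ≤ kernelProfile k q := by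
  unfold kernelProfile; positivity

lemma kernelProfile_le {k q : ℝ} (hk : 0 ≤ k) (hq : 0 ≤ q) : kernelProfile k q ≤ 3 / q ^ 5 := by
  unfold kernelProfile
  gcongr
  have h := Real.quadratic_le_exp_of_nonneg (mul_nonneg hk hq)
  have h1 : 0 < Real.exp (-k * q) := Real.exp_pos _
  have h2 : Real.exp (-k * q) * Real.exp (k * q) = 1 := by
    rw [← Real.exp_add]; simp
  nlinarith [mul_nonneg hk hq, sq_nonneg (k * q), mul_le_mul_of_nonneg_left h h1.le,
    mul_nonneg h1.le (sq_nonneg (k * q))]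

lemma kernelProfile_mul (k q η : ℝ) :
    kernelProfile k (η * q) = kernelProfile (k * η) q / η ^ 5 := by
  unfold kernelProfile
  rw [show -k * (η * q) = -(k * η) * q by ring, div_div]
  ring_nf

lemma hasDerivAt_div_sqrt_cube (r : ℝ) :
    HasDerivAt (fun r => (r / √(r ^ 2 + 1 ^ 2)) ^ 3) (r ^ 2 * (3 / √(r ^ 2 + 1 ^ 2) ^ 5)) r := by
  have hpos : 0 < r ^ 2 + 1 ^ 2 := by positivity
  have h1 := (((hasDerivAt_pow 2 r).add_const (1 ^ 2 : ℝ)).sqrt hpos.ne')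
  have hne := (Real.sqrt_pos.2 hpos).ne'
  refine (((hasDerivAt_id r).div h1 hne).pow 3).congr_deriv ?_
  have hs : √(r ^ 2 + 1 ^ 2) ^ 2 = r ^ 2 + 1 ^ 2 := Real.sq_sqrt hpos.le
  simp only [one_pow] at hs hne
  simp
  generalize √(r ^ 2 + 1) = q at *
  field_simp
  linear_combination r ^ 2 * hs

lemma tendsto_div_sqrt_cube :
    Tendsto (fun r : ℝ => (r / √(r ^ 2 + 1 ^ 2)) ^ 3) atTop (𝓝 1) := by
  have h : Tendsto (fun r : ℝ => √(1 + (r ^ 2)⁻¹)⁻¹ ^ 3) atTop (𝓝 (√(1 + 0)⁻¹ ^ 3)) := by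
    have h0 : Tendsto (fun r : ℝ => (r ^ 2)⁻¹) atTop (𝓝 0) :=
      tendsto_inv_atTop_zero.comp (tendsto_pow_atTop (by norm_num))
    exact (((h0.const_add 1).inv₀ (by norm_num)).sqrt).pow 3
  rw [add_zero, inv_one, Real.sqrt_one, one_pow] at h
  refine h.congr' ?_
  filter_upwards [eventually_gt_atTop 0] with r hr
  congr 1
  rw [show r ^ 2 + 1 ^ 2 = r ^ 2 * (1 + (r ^ 2)⁻¹) by field_simp,
    Real.sqrt_mul (by positivity), Real.sqrt_sq hr.le, Real.sqrt_inv]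
  field_simp

lemma integrableOn_sq_mul_inv_pow :
    IntegrableOn (fun r : ℝ => r ^ 2 * (3 / √(r ^ 2 + 1 ^ 2) ^ 5)) (Ioi 0) :=
  integrableOn_Ioi_deriv_of_nonneg' (fun r _ => hasDerivAt_div_sqrt_cube r)
    (fun r _ => by positivity) tendsto_div_sqrt_cube

lemma integrable_inv_softNorm : Integrable fun x : ℝ³ => 3 / softNorm 1 x ^ 5 := by
  refine (integrable_fun_norm_addHaar volume (f := fun r => 3 / √(r ^ 2 + 1 ^ 2) ^ 5)).2 ?_
  simpa using integrableOn_sq_mul_inv_pow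

lemma integral_inv_softNorm : ∫ x : ℝ³, 3 / softNorm 1 x ^ 5 = 4 * π := by
  have h := integral_fun_norm_addHaar (volume : Measure ℝ³) fun r => 3 / √(r ^ 2 + 1 ^ 2) ^ 5
  have h2 := integral_Ioi_of_hasDerivAt_of_tendsto' (fun r _ => hasDerivAt_div_sqrt_cube r)
    integrableOn_sq_mul_inv_pow tendsto_div_sqrt_cube
  simp only [finrank_euclideanSpace, Fintype.card_fin, smul_eq_mul, nsmul_eq_mul,
    Nat.add_one_sub_one, h2, Measure.real,
    EuclideanSpace.volume_ball_fin_three] at h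
  rw [show (fun x : ℝ³ => 3 / softNorm 1 x ^ 5) = fun x => 3 / √(‖x‖ ^ 2 + 1 ^ 2) ^ 5 from rfl, h]
  rw [ENNReal.ofReal_one, one_pow, one_mul, ENNReal.toReal_ofReal (by positivity)]
  norm_num
  ring

lemma integral_mul_kernelProfile_eq (φ : ℝ³ → ℝ) (k : ℝ) {η : ℝ} (hη : 0 < η) :
    ∫ x, φ x * (η ^ 2 * kernelProfile k (softNorm η x))
      = ∫ z, φ (η • z) * kernelProfile (k * η) (softNorm 1 z) := by
  have h := Measure.integral_comp_smul volume
    (fun x : ℝ³ => φ x * (η ^ 2 * kernelProfile k (softNorm η x))) η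
  have hη' : |(η ^ 3)⁻¹| = (η ^ 3)⁻¹ := abs_of_pos (by positivity)
  rw [finrank_euclideanSpace, Fintype.card_fin, hη', smul_eq_mul] at h
  rw [← mul_right_inj' (inv_ne_zero (pow_ne_zero 3 hη.ne')), ← h, ← integral_const_mul]
  congr 1 with z
  rw [softNorm_smul hη.le, kernelProfile_mul]
  field_simp

lemma tendsto_integral_mul_kernelProfile {φ : ℝ³ → ℝ} (hφ : Continuous φ)
    (hφc : HasCompactSupport φ) {k : ℝ} (hk : 0 ≤ k) :
    Tendsto (fun η : ℝ => ∫ x, φ x * (η ^ 2 * kernelProfile k (softNorm η x))) (𝓝[>] 0)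
      (𝓝 (4 * π * φ 0)) := by
  obtain ⟨C, hC⟩ := hφc.exists_bound_of_continuous hφ
  have hlim : ∫ z : ℝ³, φ 0 * (3 / softNorm 1 z ^ 5) = 4 * π * φ 0 := by
    rw [integral_const_mul, integral_inv_softNorm, mul_comm]
  rw [← hlim]
  have key : Tendsto (fun η : ℝ => ∫ z : ℝ³, φ (η • z) * kernelProfile (k * η) (softNorm 1 z))
      (𝓝[>] 0) (𝓝 (∫ z : ℝ³, φ 0 * (3 / softNorm 1 z ^ 5))) := by
    refine tendsto_integral_filter_of_dominated_convergence
      (fun z => C * (3 / softNorm 1 z ^ 5)) ?_ ?_ (integrable_inv_softNorm.const_mul C) ?_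
    · refine Eventually.of_forall fun η => Continuous.aestronglyMeasurable ?_
      have := continuous_kernelProfile_softNorm (k * η) one_pos
      fun_prop
    · filter_upwards [self_mem_nhdsWithin] with η (hη : 0 < η)
      refine Eventually.of_forall fun z => ?_
      have hkη : 0 ≤ k * η := by positivity
      have hq := (softNorm_pos one_pos z).le
      rw [norm_mul, Real.norm_of_nonneg (kernelProfile_nonneg hkη hq)]
      exact mul_le_mul (hC _) (kernelProfile_le hkη hq) (kernelProfile_nonneg hkη hq)
        ((norm_nonneg _).trans (hC 0))
    · refine Eventually.of_forall fun z => ?_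
      have h : Continuous fun η : ℝ => φ (η • z) * kernelProfile (k * η) (softNorm 1 z) := by
        unfold kernelProfile; fun_prop
      have h0 := h.tendsto 0
      simp only [zero_smul, kernelProfile, mul_zero, neg_zero, zero_mul, Real.exp_zero] at h0
      refine (Tendsto.mono_left h0 nhdsWithin_le_nhds).congr' ?_ |>.trans (le_of_eq ?_)
      · exact Eventually.of_forall fun η => rfl
      · norm_num
  refine key.congr' ?_
  filter_upwards [self_mem_nhdsWithin] with η hη
  exact (integral_mul_kernelProfile_eq φ k hη).symm

lemma integrable_exp_div_norm {k : ℝ} (hk : 0 < k) :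
    Integrable fun x : ℝ³ => Real.exp (-k * ‖x‖) / ‖x‖ := by
  refine (integrable_fun_norm_addHaar volume (f := fun r => Real.exp (-k * r) / r)).2 ?_
  have h := integrableOn_rpow_mul_exp_neg_mul_rpow (s := 1) (p := 1) (b := k) (by norm_num)
    one_pos hk
  refine h.congr_fun (fun r (hr : 0 < r) => ?_) measurableSet_Ioi
  simp
  field_simp

lemma exp_div_anti {k a b : ℝ} (hk : 0 ≤ k) (ha : 0 < a) (hab : a ≤ b) :
    Real.exp (-k * b) / b ≤ Real.exp (-k * a) / a := by
  have : -k * b ≤ -k * a := by nlinarith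
  gcongr

lemma tendsto_integral_mul_exp_div_softNorm {ψ : ℝ³ → ℝ} (hψ : Continuous ψ)
    (hψc : HasCompactSupport ψ) {k : ℝ} (hk : 0 < k) :
    Tendsto (fun η : ℝ => ∫ x, ψ x * (Real.exp (-k * softNorm η x) / softNorm η x)) (𝓝[>] 0)
      (𝓝 (∫ x, ψ x * (Real.exp (-k * ‖x‖) / ‖x‖))) := by
  obtain ⟨C, hC⟩ := hψc.exists_bound_of_continuous hψ
  have hne : ∀ᵐ x : ℝ³, x ≠ 0 := Measure.ae_ne volume 0
  refine tendsto_integral_filter_of_dominated_convergence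
    (fun x => C * (Real.exp (-k * ‖x‖) / ‖x‖)) ?_ ?_ ((integrable_exp_div_norm hk).const_mul C) ?_
  · filter_upwards [self_mem_nhdsWithin] with η hη
    exact (hψ.mul (continuous_exp_div_softNorm k hη)).aestronglyMeasurable
  · filter_upwards [self_mem_nhdsWithin] with η (hη : 0 < η)
    filter_upwards [hne] with x hx
    have hq := softNorm_pos hη x
    rw [norm_mul, Real.norm_of_nonneg (by positivity : 0 ≤ Real.exp (-k * softNorm η x) / _)]
    exact mul_le_mul (hC x) (exp_div_anti hk.le (norm_pos_iff.2 hx) (norm_le_softNorm η x))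
      (by positivity) ((norm_nonneg _).trans (hC 0))
  · filter_upwards [hne] with x hx
    have hx' : ‖x‖ ≠ 0 := norm_ne_zero_iff.2 hx
    have hq : Tendsto (fun η : ℝ => softNorm η x) (𝓝[>] 0) (𝓝 ‖x‖) := by
      have h : Continuous fun η : ℝ => softNorm η x := by unfold softNorm; fun_prop
      have h0 := h.tendsto 0
      simp only [softNorm, ne_eq, OfNat.ofNat_ne_zero, not_false_eq_true, zero_pow, add_zero,
        norm_nonneg, Real.sqrt_sq] at h0
      exact h0.mono_left nhdsWithin_le_nhds
    exact (((hq.const_mul (-k)).rexp).div hq hx').const_mul (ψ x)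

/-- `exp (-k ‖x‖) / (4 π ‖x‖)` is a fundamental solution of `k² - Δ` on `ℝ³`. -/
lemma integral_lap_sub_mul_exp_div_norm {φ : ℝ³ → ℝ} (hφ : ContDiff ℝ (⊤ : ℕ∞) φ)
    (hφc : HasCompactSupport φ) {k : ℝ} (hk : 0 < k) :
    ∫ x, (lap φ x - k ^ 2 * φ x) * (Real.exp (-k * ‖x‖) / ‖x‖) = -(4 * π * φ 0) := by
  have hψ : Continuous fun x => lap φ x - k ^ 2 * φ x :=
    (continuous_lap hφ).sub (hφ.continuous.const_mul _)
  have hψc : HasCompactSupport fun x => lap φ x - k ^ 2 * φ x :=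
    (hasCompactSupport_lap hφc).sub hφc.mul_left
  refine tendsto_nhds_unique (tendsto_integral_mul_exp_div_softNorm hψ hψc hk) ?_
  refine (tendsto_integral_mul_kernelProfile hφ.continuous hφc hk.le).neg.congr' ?_
  filter_upwards [self_mem_nhdsWithin] with η hη
  exact (integral_lap_sub_mul hφ hφc k hη).symm

lemma lap_comp_add_right (φ : ℝ³ → ℝ) (x y : ℝ³) : lap (fun z => φ (z + y)) x = lap φ (x + y) := by
  simp only [lap, fderiv_comp_add_right]
  refine Finset.sum_congr rfl fun i _ => ?_
  rw [fderiv_comp_add_right (f := fun z => fderiv ℝ φ z (EuclideanSpace.single i 1))]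

lemma yukawa_eq (ε α : ℝ) (x y : ℝ³) :
    yukawa ε α x y
      = (4 * π * ε ^ 2)⁻¹ * (Real.exp (-(α / ε) * ‖x - y‖) / ‖x - y‖) := by
  unfold yukawa
  rw [div_mul_eq_div_div, inv_mul_eq_div, div_right_comm]

lemma integral_mul_yukawa {ε α : ℝ} (hε : 0 < ε) (hα : 0 < α) {φ : ℝ³ → ℝ}
    (hφ : ContDiff ℝ (⊤ : ℕ∞) φ) (hφc : HasCompactSupport φ) (y : ℝ³) :
    ∫ x, (ε ^ 2 * lap φ x - α ^ 2 * φ x) * yukawa ε α x y = -φ y := by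
  have h := integral_lap_sub_mul_exp_div_norm (φ := fun z => φ (z + y))
    (hφ.comp (contDiff_id.add contDiff_const)) (hφc.comp_homeomorph (Homeomorph.addRight y))
    (div_pos hα hε)
  rw [← integral_add_right_eq_self _ y]
  have hpt (x : ℝ³) : (ε ^ 2 * lap φ (x + y) - α ^ 2 * φ (x + y)) * yukawa ε α (x + y) y
      = (4 * π)⁻¹ * ((lap (fun z => φ (z + y)) x - (α / ε) ^ 2 * φ (x + y)) *
        (Real.exp (-(α / ε) * ‖x‖) / ‖x‖)) := by
    rw [yukawa_eq, lap_comp_add_right, add_sub_cancel_right]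
    field_simp
  simp only [hpt]
  rw [integral_const_mul, h, zero_add]
  field_simp

lemma integrable_yukawa {ε α : ℝ} (hε : 0 < ε) (hα : 0 < α) (y : ℝ³) :
    Integrable fun x => yukawa ε α x y := by
  simp only [yukawa_eq]
  exact ((integrable_exp_div_norm (div_pos hα hε)).comp_sub_right y).const_mul _

lemma yukawa_nonneg (ε α : ℝ) (x y : ℝ³) : 0 ≤ yukawa ε α x y := by
  unfold yukawa; positivity

lemma integral_yukawa_left_eq (ε α : ℝ) (y : ℝ³) :
    ∫ x, yukawa ε α x y = ∫ x, yukawa ε α x 0 := by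
  rw [← integral_add_right_eq_self _ y]
  simp [yukawa]

lemma measurable_yukawa (ε α : ℝ) : Measurable fun p : ℝ³ × ℝ³ => yukawa ε α p.1 p.2 := by
  unfold yukawa; fun_prop

lemma integrable_mul_yukawa_prod {ε α : ℝ} (hε : 0 < ε) (hα : 0 < α) (μ : Measure ℝ³)
    [IsFiniteMeasure μ] {ψ : ℝ³ → ℝ} (hψ : Continuous ψ) (hψc : HasCompactSupport ψ) :
    Integrable (fun p : ℝ³ × ℝ³ => ψ p.1 * yukawa ε α p.1 p.2) (volume.prod μ) := by
  obtain ⟨C, hC⟩ := hψc.exists_bound_of_continuous hψ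
  have hY : Integrable (fun p : ℝ³ × ℝ³ => yukawa ε α p.1 p.2) (volume.prod μ) := by
    refine (integrable_prod_iff' (measurable_yukawa ε α).aestronglyMeasurable).2
      ⟨Eventually.of_forall fun y => integrable_yukawa hε hα y, ?_⟩
    simp only [Real.norm_of_nonneg (yukawa_nonneg _ _ _ _)]
    simp_rw [integral_yukawa_left_eq ε α]
    exact integrable_const _
  exact hY.bdd_mul (hψ.comp continuous_fst).aestronglyMeasurable
    (Eventually.of_forall fun p => hC p.1)

theorem yukawa_single_layer_distributional_solution (ε α : ℝ) (hε : 0 < ε) (hα : 0 < α)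
    (μ : Measure (EuclideanSpace ℝ (Fin 3))) (hfin : IsFiniteMeasure μ)
    (A : ℝ) (hA : 0 < A) (hreg : Upper2Regular μ A)
    (u : EuclideanSpace ℝ (Fin 3) → ℝ)
    (hu : ∀ x, u x = ∫ y, yukawa ε α x y ∂μ)
    (φ : EuclideanSpace ℝ (Fin 3) → ℝ)
    (hφ : ContDiff ℝ (⊤ : ℕ∞) φ) (hφc : HasCompactSupport φ) :
    ∫ x, (ε ^ 2 * lap φ x - α ^ 2 * φ x) * u x = -∫ y, φ y ∂μ := by
  have hψ : Continuous fun x => ε ^ 2 * lap φ x - α ^ 2 * φ x :=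
    ((continuous_lap hφ).const_mul _).sub (hφ.continuous.const_mul _)
  have hψc : HasCompactSupport fun x => ε ^ 2 * lap φ x - α ^ 2 * φ x :=
    (hasCompactSupport_lap hφc).mul_left.sub hφc.mul_left
  simp only [hu, ← integral_const_mul]
  rw [integral_integral_swap (integrable_mul_yukawa_prod hε hα μ hψ hψc), ← integral_neg]
  simp only [integral_mul_yukawa hε hα hφ hφc]
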